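/- arXiv:0912.1553 — 6 statements merged into one kernel-verified Lean document; each statement's English description precedes it below -/
import Mathlib

section
/- Let F be the octonion cochain on (ℤ/2)³ and φ the octonion associator. Then the coboundary of F equals φ: for all a, b, c ∈ (ℤ/2)³ one has F(a,b) · F(a+b,c) · F(b,c) · F(a,b+c) = φ(a,b,c). Consequently the twisted basis e_a (with product e_a • e_b = F(a,b) e_{a+b}) satisfies (e_a • e_b) • e_c = φ(a,b,c) · e_a • (e_b • e_c). -/
/-- The group `(ℤ/2)³` of labels. -/
abbrev G3 : Type := Fin 3 → ZMod 2

/-- The octonion cochain `F(a,b) = (−1)^{∑_{i≤j} aᵢbⱼ + a₁a₂b₃ + a₁b₂a₃ + b₁a₂a₃}`,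
with components read as representatives in `{0,1}`. -/
def octF (a b : G3) : ℤ :=
  (-1) ^ ((a 0).val * (b 0).val + (a 0).val * (b 1).val + (a 0).val * (b 2).val
    + (a 1).val * (b 1).val + (a 1).val * (b 2).val + (a 2).val * (b 2).val
    + (a 0).val * (a 1).val * (b 2).val + (a 0).val * (b 1).val * (a 2).val
    + (b 0).val * (a 1).val * (a 2).val)

/-- The octonion associator `φ(a,b,c) = (−1)^{a·(b×c)}`, with the triple product
computed in `ℤ/2`. -/
def octPhi (a b c : G3) : ℤ :=
  (-1) ^ (a 0 * (b 1 * c 2 + b 2 * c 1) + a 1 * (b 2 * c 0 + b 0 * c 2)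
    + a 2 * (b 0 * c 1 + b 1 * c 0)).val

/-- Basis element `e_a` of the (twisted) group algebra of `(ℤ/2)³`. -/
def octE (a : G3) : G3 → ℤ := Pi.single a 1

/-- The twisted product on the group algebra of `(ℤ/2)³`, determined by
`e_a • e_b = F(a,b) e_{a+b}`. -/
def octMul (f g : G3 → ℤ) : G3 → ℤ :=
  fun c => ∑ a : G3, f a * g (a + c) * octF a (a + c)

/-- The sign character `x ↦ (−1)^x` of `ℤ/2`. -/
def zmodTwoSign (x : ZMod 2) : ℤ := (-1) ^ x.val

theorem zmodTwoSign_add (x y : ZMod 2) :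
    zmodTwoSign (x + y) = zmodTwoSign x * zmodTwoSign y := by
  revert x y
  decide

theorem zmodTwoSign_natCast (n : ℕ) : zmodTwoSign n = (-1) ^ n := by
  rw [zmodTwoSign, ZMod.val_natCast, ← neg_one_pow_eq_pow_mod_two]

theorem zmodTwoSign_mul_self (x : ZMod 2) : zmodTwoSign x * zmodTwoSign x = 1 := by
  rw [← zmodTwoSign_add, CharTwo.add_self_eq_zero]
  rfl

/-- The exponent of the octonion cochain, computed in `ℤ/2`. -/
def octExponent (a b : G3) : ZMod 2 :=
  a 0 * b 0 + a 0 * b 1 + a 0 * b 2 + a 1 * b 1 + a 1 * b 2 + a 2 * b 2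
    + a 0 * a 1 * b 2 + a 0 * b 1 * a 2 + b 0 * a 1 * a 2

theorem octF_eq_zmodTwoSign (a b : G3) : octF a b = zmodTwoSign (octExponent a b) := by
  rw [octF, ← zmodTwoSign_natCast]
  simp [octExponent]

theorem octF_mul_self (a b : G3) : octF a b * octF a b = 1 := by
  rw [octF_eq_zmodTwoSign, zmodTwoSign_mul_self]

theorem octF_coboundary (a b c : G3) :
    octF a b * octF (a + b) c * octF b c * octF a (b + c) = octPhi a b c := by
  simp only [octF_eq_zmodTwoSign, ← zmodTwoSign_add]
  change zmodTwoSign _ = zmodTwoSign _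
  congr 1
  simp only [octExponent, Pi.add_apply]
  grind

theorem octMul_single (a b : G3) (x y : ℤ) :
    octMul (Pi.single a x) (Pi.single b y) = Pi.single (a + b) (x * y * octF a b) := by
  funext c
  rw [octMul, Finset.sum_eq_single a]
  · rcases eq_or_ne c (a + b) with rfl | hc
    · have hab : a + (a + b) = b := by
        rw [← add_assoc, CharTwo.add_self_eq_zero, zero_add]
      simp [hab]
    · have hac : a + c ≠ b := by
        rintro rfl
        exact hc (by rw [← add_assoc, CharTwo.add_self_eq_zero, zero_add])
      simp [hc, hac]
  · intro d _ hd
    simp [hd]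
  · simp

/-- the coboundary of the octonion cochain `F` equals the octonion
associator `φ`, and consequently the twisted basis elements satisfy
`(e_a • e_b) • e_c = φ(a,b,c) · e_a • (e_b • e_c)`. -/
theorem octF_coboundary_eq_octPhi :
    ∀ a b c : G3,
      octF a b * octF (a + b) c * octF b c * octF a (b + c) = octPhi a b c ∧
      octMul (octMul (octE a) (octE b)) (octE c)
        = octPhi a b c • octMul (octE a) (octMul (octE b) (octE c)) := by
  intro a b c
  refine ⟨octF_coboundary a b c, ?_⟩
  simp only [octE, octMul_single, ← Pi.single_smul, add_assoc, one_mul, mul_one, smul_eq_mul]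
  congr 1
  rw [← octF_coboundary]
  linear_combination (-(octF a b * octF (a + b) c)) *
    (octF b c * octF b c * octF_mul_self a (b + c) + octF_mul_self b c)
end

section
/- Three twisted basis elements associate if and only if their labels are linearly dependent over ℤ/2: for all a, b, c ∈ (ℤ/2)³, the identity F(a,b) · F(a+b,c) = F(b,c) · F(a,b+c) holds if and only if the family (a, b, c) is NOT linearly independent over the field ℤ/2 (equivalently, φ(a,b,c) = −1 exactly when a, b, c are linearly independent over ℤ/2). -/
/-- The exponent of `octF`, as a cubic polynomial over `ℤ/2`. -/
def octFExponent (a b : G3) : ZMod 2 :=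
  a 0 * b 0 + a 0 * b 1 + a 0 * b 2 + a 1 * b 1 + a 1 * b 2 + a 2 * b 2
    + a 0 * a 1 * b 2 + a 0 * b 1 * a 2 + b 0 * a 1 * a 2

theorem neg_one_pow_val_natCast (n : ℕ) : (-1 : ℤ) ^ (n : ZMod 2).val = (-1) ^ n := by
  rw [ZMod.val_natCast, ← neg_one_pow_eq_pow_mod_two]

theorem neg_one_pow_val_add (x y : ZMod 2) :
    (-1 : ℤ) ^ (x + y).val = (-1) ^ x.val * (-1) ^ y.val := by
  revert x y
  decide

theorem neg_one_pow_val_inj (x y : ZMod 2) :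
    (-1 : ℤ) ^ x.val = (-1) ^ y.val ↔ x = y := by
  revert x y
  decide

theorem octF_eq (a b : G3) : octF a b = (-1) ^ (octFExponent a b).val := by
  rw [octF, ← neg_one_pow_val_natCast]
  simp [octFExponent]

/-- The coboundary of the exponent of `octF` is the triple product. -/
theorem octFExponent_coboundary (a b c : G3) :
    octFExponent a b + octFExponent (a + b) c + octFExponent b c + octFExponent a (b + c) =
      (Matrix.of ![a, b, c]).det := by
  simp only [octFExponent, Matrix.det_fin_three, Pi.add_apply, Matrix.of_apply, Matrix.cons_val]
  grind

theorem octPhi_eq (a b c : G3) : octPhi a b c = (-1) ^ ((Matrix.of ![a, b, c]).det).val := by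
  rw [octPhi, neg_one_pow_val_inj, Matrix.det_fin_three]
  simp only [Matrix.of_apply, Matrix.cons_val]
  grind

theorem linearIndependent_iff_det_ne_zero (a b c : G3) :
    LinearIndependent (ZMod 2) ![a, b, c] ↔ (Matrix.of ![a, b, c]).det ≠ 0 := by
  rw [← isUnit_iff_ne_zero, ← Matrix.isUnit_iff_isUnit_det,
    ← Matrix.linearIndependent_rows_iff_isUnit]
  rfl

/-- three twisted basis elements associate (i.e. the cocycle identity
`F(a,b)F(a+b,c) = F(b,c)F(a,b+c)` holds) if and only if the labels `a,b,c` are NOT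
linearly independent over `ℤ/2`; equivalently `φ(a,b,c) = −1` exactly when `a,b,c`
are linearly independent over `ℤ/2`. -/
theorem oct_associate_iff_linearly_dependent :
    ∀ a b c : G3,
      (octF a b * octF (a + b) c = octF b c * octF a (b + c) ↔
        ¬ LinearIndependent (ZMod 2) ![a, b, c]) ∧
      (octPhi a b c = -1 ↔ LinearIndependent (ZMod 2) ![a, b, c]) := by
  intro a b c
  have hcob := octFExponent_coboundary a b c
  rw [linearIndependent_iff_det_ne_zero, octPhi_eq]
  simp only [octF_eq, ← neg_one_pow_val_add, neg_one_pow_val_inj]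
  constructor
  · grind
  · generalize (Matrix.of ![a, b, c]).det = d
    revert d
    decide
end

section
/- The octonion cochain is altercommutative: for all a, b ∈ (ℤ/2)³, F(a,b) = −F(b,a) if and only if the pair (a, b) is linearly independent over ℤ/2; otherwise (i.e. if a = 0, b = 0 or a = b) F(a,b) = F(b,a). Consequently two twisted basis elements e_a, e_b anticommute exactly when a and b are distinct and both nonzero, and commute otherwise. -/
/-- The cochain is antisymmetric exactly at pairs of distinct nonzero labels. -/
lemma octF_eq_neg_iff :
    ∀ a b : G3, octF a b = - octF b a ↔ (a ≠ b ∧ a ≠ 0 ∧ b ≠ 0) := by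
  decide +kernel

/-- The cochain is symmetric at the remaining pairs. -/
lemma octF_comm_of_dependent :
    ∀ a b : G3, ¬ (a ≠ b ∧ a ≠ 0 ∧ b ≠ 0) → octF a b = octF b a := by
  decide +kernel

/-- Over `ℤ/2`, a pair of vectors is linearly independent iff the vectors are distinct
and nonzero. -/
lemma linearIndependent_pair_zmod_two {M : Type*} [AddCommGroup M] [Module (ZMod 2) M]
    (a b : M) :
    LinearIndependent (ZMod 2) ![a, b] ↔ (a ≠ b ∧ a ≠ 0 ∧ b ≠ 0) := by
  constructor
  · intro h
    exact ⟨fun hab => zero_ne_one (h.injective (a₁ := 0) (a₂ := 1) hab),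
      h.ne_zero 0, h.ne_zero 1⟩
  · rintro ⟨hab, ha, hb⟩
    rw [LinearIndependent.pair_iff' ha]
    intro r
    have zero_or_one : ∀ r : ZMod 2, r = 0 ∨ r = 1 := by decide
    obtain rfl | rfl := zero_or_one r
    · simpa using hb.symm
    · simpa using hab

/-- The defining relation `e_a • e_b = F(a,b) e_{a+b}` of the twisted product. -/
lemma octMul_octE (a b : G3) :
    octMul (octE a) (octE b) = Pi.single (a + b) (octF a b) := by
  funext c
  have key : a + c = b ↔ c = a + b := by
    revert a b c
    decide +kernel
  unfold octMul octE
  rw [Finset.sum_eq_single a]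
  · by_cases h : a + c = b
    · rw [h, key.1 h]
      simp
    · simp [h, mt key.2 h]
  · intro x _ hx
    simp [hx]
  · simp

/-- the octonion cochain is altercommutative: `F(a,b) = −F(b,a)` iff the
pair `(a,b)` is linearly independent over `ℤ/2`, and otherwise (`a = 0`, `b = 0` or
`a = b`) `F(a,b) = F(b,a)`.  Consequently the twisted basis elements `e_a, e_b`
anticommute exactly when `a ≠ b` and both are nonzero, and commute otherwise. -/
theorem octF_altercommutative :
    ∀ a b : G3,
      (octF a b = - octF b a ↔ LinearIndependent (ZMod 2) ![a, b]) ∧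
      ((a = 0 ∨ b = 0 ∨ a = b) → octF a b = octF b a) ∧
      (octMul (octE a) (octE b) = - octMul (octE b) (octE a) ↔
        (a ≠ b ∧ a ≠ 0 ∧ b ≠ 0)) ∧
      (¬ (a ≠ b ∧ a ≠ 0 ∧ b ≠ 0) →
        octMul (octE a) (octE b) = octMul (octE b) (octE a)) := by
  intro a b
  refine ⟨(octF_eq_neg_iff a b).trans (linearIndependent_pair_zmod_two a b).symm,
    fun h => octF_comm_of_dependent a b (by tauto), ?_, fun h => ?_⟩
  · rw [octMul_octE, octMul_octE, add_comm b a, ← Pi.single_neg, Pi.single_inj]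
    exact octF_eq_neg_iff a b
  · rw [octMul_octE, octMul_octE, add_comm b a, octF_comm_of_dependent a b h]
end

section
/- The quaternions ℍ are the cochain twist of the group algebra of (ℤ/2)²: define q : (ℤ/2)² → ℍ by q(0,0) = 1, q(0,1) = i, q(1,0) = j, q(1,1) = k. Then for all a = (a₁,a₂), b = (b₁,b₂) ∈ (ℤ/2)², q(a) * q(b) = F₂(a,b) · q(a+b), where F₂(a,b) = (−1)^{a₁b₁ + a₁b₂ + a₂b₂}. -/
/-- The group `(ℤ/2)²` of labels. -/
abbrev G2 : Type := ZMod 2 × ZMod 2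

/-- The quaternion cochain `F₂(a,b) = (−1)^{a₁b₁ + a₁b₂ + a₂b₂}`, with components read
as representatives in `{0,1}`. -/
def qF (a b : G2) : ℝ :=
  (-1) ^ (a.1.val * b.1.val + a.1.val * b.2.val + a.2.val * b.2.val)

/-- The basis of `ℍ` indexed by `(ℤ/2)²`: `q(0,0) = 1`, `q(0,1) = i`, `q(1,0) = j`,
`q(1,1) = k`. -/
noncomputable def qGen (a : G2) : Quaternion ℝ :=
  if a = (0, 0) then 1
  else if a = (0, 1) then ⟨0, 1, 0, 0⟩
  else if a = (1, 0) then ⟨0, 0, 1, 0⟩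
  else ⟨0, 0, 0, 1⟩

theorem label_cases : ∀ a : G2, a = (0, 0) ∨ a = (0, 1) ∨ a = (1, 0) ∨ a = (1, 1) := by
  decide

theorem re_qGen (a : G2) : (qGen a).re = if a = (0, 0) then 1 else 0 := by
  rcases label_cases a with rfl | rfl | rfl | rfl
  · rfl
  all_goals simp [qGen]

theorem imI_qGen (a : G2) : (qGen a).imI = if a = (0, 1) then 1 else 0 := by
  rcases label_cases a with rfl | rfl | rfl | rfl
  · rfl
  all_goals simp [qGen]

theorem imJ_qGen (a : G2) : (qGen a).imJ = if a = (1, 0) then 1 else 0 := by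
  rcases label_cases a with rfl | rfl | rfl | rfl
  · rfl
  all_goals simp [qGen]

theorem imK_qGen (a : G2) : (qGen a).imK = if a = (1, 1) then 1 else 0 := by
  rcases label_cases a with rfl | rfl | rfl | rfl
  · rfl
  all_goals simp [qGen]

/-- the quaternions are the cochain twist of the group algebra of
`(ℤ/2)²`: for all `a b ∈ (ℤ/2)²`, `q(a) * q(b) = F₂(a,b) · q(a+b)`. -/
theorem quaternions_are_cochain_twist :
    ∀ a b : G2, qGen a * qGen b = qF a b • qGen (a + b) := by
  intro a b
  have one_add_one : (1 + 1 : ZMod 2) = 0 := by decide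
  have val_one : (1 : ZMod 2).val = 1 := rfl
  rcases label_cases a with rfl | rfl | rfl | rfl <;>
    rcases label_cases b with rfl | rfl | rfl | rfl <;>
    ext <;> simp [re_qGen, imI_qGen, imJ_qGen, imK_qGen, qF, one_add_one, val_one, pow_succ]
end

section
/- The cochain-twisted product of the coordinate functions of the 2-sphere satisfies the q²-commutation relations of the Podles sphere with q² = 1 − 2c₁: exactly in the polynomial ring R one has x₋ • x₃ = (1 − 2c₁) · (x₃ • x₋) and x₃ • x₊ = (1 − 2c₁) · (x₊ • x₃). (These are the relations zK = q²Kz of the Podles sphere, with K ∝ x₃, z ∝ x₋.) -/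
open MvPolynomial

/-- The polynomial ring `R = ℂ[x₊, x₋, x₃]`, with `X 0 = x₊`, `X 1 = x₋`, `X 2 = x₃`. -/
noncomputable abbrev Rsph : Type := MvPolynomial (Fin 3) ℂ

/-- The derivation `X` of `R` with `X x₊ = 0`, `X x₋ = −2i x₃`, `X x₃ = i x₊`
(the action of the sl₂ element `x` by rotational vector fields). -/
noncomputable def Xder : Derivation ℂ Rsph Rsph :=
  MvPolynomial.mkDerivation ℂ
    ![0, C (-2 * Complex.I) * X 2, C Complex.I * X 0]

/-- The derivation `Y` of `R` with `Y x₊ = 2i x₃`, `Y x₋ = 0`, `Y x₃ = −i x₋`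
(the action of the sl₂ element `y` by rotational vector fields). -/
noncomputable def Yder : Derivation ℂ Rsph Rsph :=
  MvPolynomial.mkDerivation ℂ
    ![C (2 * Complex.I) * X 2, 0, C (-Complex.I) * X 1]

/-- The cochain-twisted product `a • b = ab + c₁ (Xa)(Yb) + c₂ (X²a)(Y²b)`. -/
noncomputable def twProd (c₁ c₂ : ℂ) (a b : Rsph) : Rsph :=
  a * b + C c₁ * (Xder a * Yder b) + C c₂ * (Xder (Xder a) * Yder (Yder b))

/-- The ideal of the unit 2-sphere, generated by `x₊x₋ + x₃² − 1`. -/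
noncomputable def sphereIdeal : Ideal Rsph :=
  Ideal.span {X 0 * X 1 + X 2 ^ 2 - 1}

theorem Xder_X_zero : Xder (X 0) = 0 := by simp [Xder, mkDerivation_X]

theorem Xder_X_one : Xder (X 1) = C (-2 * Complex.I) * X 2 := by simp [Xder, mkDerivation_X]

theorem Xder_X_two : Xder (X 2) = C Complex.I * X 0 := by simp [Xder, mkDerivation_X]

theorem Yder_X_zero : Yder (X 0) = C (2 * Complex.I) * X 2 := by simp [Yder, mkDerivation_X]

theorem Yder_X_one : Yder (X 1) = 0 := by simp [Yder, mkDerivation_X]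

theorem Yder_X_two : Yder (X 2) = C (-Complex.I) * X 1 := by simp [Yder, mkDerivation_X]

theorem Xder_C_mul (a : ℂ) (p : Rsph) : Xder (C a * p) = C a * Xder p := by
  rw [← smul_eq_C_mul, Derivation.map_smul, smul_eq_C_mul]

theorem Yder_C_mul (a : ℂ) (p : Rsph) : Yder (C a * p) = C a * Yder p := by
  rw [← smul_eq_C_mul, Derivation.map_smul, smul_eq_C_mul]

theorem C_I_mul_C_I : (C Complex.I * C Complex.I : Rsph) = -1 := by
  rw [← C_mul, Complex.I_mul_I, C_neg, C_1]

/-- the twisted product satisfies the `q²`-commutation relations of the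
Podles sphere with `q² = 1 − 2c₁`, exactly in `R`:
`x₋ • x₃ = (1 − 2c₁)·(x₃ • x₋)` and `x₃ • x₊ = (1 − 2c₁)·(x₊ • x₃)`. -/
theorem podles_q_commutation (c₁ c₂ : ℂ) :
    twProd c₁ c₂ (X 1) (X 2) = C (1 - 2 * c₁) * twProd c₁ c₂ (X 2) (X 1) ∧
    twProd c₁ c₂ (X 2) (X 0) = C (1 - 2 * c₁) * twProd c₁ c₂ (X 0) (X 2) := by
  have hC2 : (C 2 : Rsph) = 2 := map_ofNat C 2
  simp only [twProd, Xder_X_zero, Xder_X_one, Xder_X_two, Yder_X_zero, Yder_X_one, Yder_X_two,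
    Xder_C_mul, Yder_C_mul, map_zero, mul_zero, zero_mul, add_zero]
  simp only [C_sub, C_mul, C_neg, C_1, hC2]
  constructor
  · linear_combination 2 * C c₁ * X 1 * X 2 * C_I_mul_C_I
  · linear_combination 2 * C c₁ * X 0 * X 2 * C_I_mul_C_I
end

section
/- Modulo the sphere ideal I, the cochain-twisted products of the sphere coordinates satisfy: x₃ • x₃ ≡ (1 − c₁)·x₃² + c₁, x₊ • x₋ ≡ 1 − x₃², and hence (1 − c₁)·(x₊ • x₋) ≡ 1 − x₃ • x₃ (mod I). (This is the Podles sphere relation z*z = 1 − K² on the generators, with K ∝ x₃, z ∝ x₋, z* ∝ x₊.) -/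
open MvPolynomial

theorem twProd_X_zero_X_one (c₁ c₂ : ℂ) : twProd c₁ c₂ (X 0) (X 1) = X 0 * X 1 := by
  simp [twProd, Xder_X_zero]

theorem twProd_X_two_X_two (c₁ c₂ : ℂ) :
    twProd c₁ c₂ (X 2) (X 2) = X 2 ^ 2 + C c₁ * (X 0 * X 1) := by
  have hI : (C Complex.I * C (-Complex.I) : Rsph) = 1 := by
    rw [← C_mul]
    simp
  have hX : Xder (C Complex.I * X 0) = 0 := by
    rw [← smul_eq_C_mul, Derivation.map_smul, Xder_X_zero, smul_zero]
  rw [twProd, Xder_X_two, Yder_X_two, hX]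
  linear_combination C c₁ * (X 0 * X 1) * hI

/-- modulo the sphere ideal `I`, `x₃ • x₃ ≡ (1 − c₁)x₃² + c₁`,
`x₊ • x₋ ≡ 1 − x₃²`, and hence `(1 − c₁)·(x₊ • x₋) ≡ 1 − x₃ • x₃ (mod I)`
(the Podles relation `z*z = 1 − K²` on the generators). -/
theorem podles_sphere_relation (c₁ c₂ : ℂ) :
    twProd c₁ c₂ (X 2) (X 2) - (C (1 - c₁) * X 2 ^ 2 + C c₁) ∈ sphereIdeal ∧
    twProd c₁ c₂ (X 0) (X 1) - (1 - X 2 ^ 2) ∈ sphereIdeal ∧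
    C (1 - c₁) * twProd c₁ c₂ (X 0) (X 1) - (1 - twProd c₁ c₂ (X 2) (X 2))
      ∈ sphereIdeal := by
  have hmem (r : Rsph) : r * (X 0 * X 1 + X 2 ^ 2 - 1) ∈ sphereIdeal :=
    Ideal.mul_mem_left _ r (Ideal.subset_span rfl)
  rw [twProd_X_zero_X_one, twProd_X_two_X_two, C_sub, C_1]
  refine ⟨?_, ?_, ?_⟩
  · convert hmem (C c₁) using 1
    ring
  · convert hmem 1 using 1
    ring
  · convert hmem 1 using 1
    ring
end
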